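/- arXiv:1204.2044 — 5 statements merged into one kernel-verified Lean document; each statement's English description precedes it below -/
import Mathlib

section
/- Let d ≥ 2 be an integer, let H be a non-empty closed subset of ℝ^d which is a union of linear hyperplanes, and let C = S ∩ H where S is the unit sphere of ℝ^d. Then there exist a constant K > 0 and a sequence (u_n) of points of C such that for each x ∈ C there exists a sequence of positive integers (p_n) with p_n ≤ n for all n, p_n → ∞, and ‖x − u_{p_n}‖ ≤ K / n^{1/(d−1)} for every n. -/
open Filter Topology Set

open Metric MeasureTheory Module in
/-- Volume comparison with a spherical shell: the balls of radius `r` around the points of a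
separated subset of the unit sphere are disjoint and lie in a shell of width `2 * r`. -/
theorem card_mul_pow_le_of_separated_sphere {E : Type*} [NormedAddCommGroup E] [NormedSpace ℝ E]
    [FiniteDimensional ℝ E] [Nontrivial E] {s : Finset E} (hs : (s : Set E) ⊆ sphere 0 1) {r : ℝ}
    (hr : 0 < r) (hr1 : r ≤ 1) (hsep : ∀ x ∈ s, ∀ y ∈ s, x ≠ y → 2 * r ≤ dist x y) :
    (s.card : ℝ) * r ^ (finrank ℝ E - 1) ≤ finrank ℝ E * 2 ^ finrank ℝ E := by
  borelize E
  let μ : Measure E := Measure.addHaar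
  set D := finrank ℝ E with hD
  have hDpos : 0 < D := finrank_pos
  have hv : 0 < μ.real (ball (0 : E) 1) :=
    ENNReal.toReal_pos (measure_ball_pos μ _ one_pos).ne' measure_ball_lt_top.ne
  have hdisj : (s : Set E).PairwiseDisjoint fun x ↦ ball x r := by
    intro x hx y hy hxy
    apply ball_disjoint_ball
    linarith [hsep x hx y hy hxy]
  have hsub : (⋃ x ∈ s, ball x r) ∪ ball 0 (1 - r) ⊆ ball (0 : E) (1 + r) := by
    intro y hy
    simp only [mem_union, mem_iUnion, exists_prop, mem_ball, dist_zero_right] at hy ⊢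
    rcases hy with ⟨x, hx, hxy⟩ | hy
    · have h1 : ‖x‖ = 1 := by simpa using hs hx
      have := norm_le_norm_add_norm_sub x y
      rw [norm_sub_rev, ← dist_eq_norm] at this
      linarith
    · linarith
  have hdisj' : Disjoint (⋃ x ∈ s, ball x r) (ball (0 : E) (1 - r)) := by
    simp only [disjoint_iUnion_left]
    intro x hx
    apply ball_disjoint_ball
    have h1 : ‖x‖ = 1 := by simpa using hs hx
    rw [dist_zero_right, h1]
    linarith
  have hμ := measureReal_mono (μ := μ) hsub measure_ball_lt_top.ne
  have hfin : μ (⋃ x ∈ s, ball x r) ≠ ⊤ :=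
    ((measure_mono (subset_union_left.trans hsub)).trans_lt measure_ball_lt_top).ne
  rw [measureReal_union hdisj' measurableSet_ball hfin measure_ball_lt_top.ne,
    measureReal_biUnion_finset hdisj (fun _ _ ↦ measurableSet_ball)
      (fun _ _ ↦ measure_ball_lt_top.ne)] at hμ
  simp only [← Measure.addHaar_real_closedBall_eq_addHaar_real_ball μ _ r,
    ← Measure.addHaar_real_closedBall_eq_addHaar_real_ball μ _ (1 - r),
    ← Measure.addHaar_real_closedBall_eq_addHaar_real_ball μ _ (1 + r)] at hμ
  rw [Measure.addHaar_real_closedBall μ _ (by linarith : 0 ≤ 1 - r),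
    Measure.addHaar_real_closedBall μ _ (by linarith : 0 ≤ 1 + r)] at hμ
  simp only [Measure.addHaar_real_closedBall μ _ hr.le, Finset.sum_const, nsmul_eq_mul] at hμ
  rw [← mul_assoc, ← add_mul, mul_le_mul_iff_left₀ hv, ← hD] at hμ
  have hpow := (le_abs_self _).trans (abs_pow_sub_pow_le (1 + r) (1 - r) D)
  have hmax : max |1 + r| |1 - r| ≤ 2 := by
    rw [abs_of_nonneg (by linarith), abs_of_nonneg (by linarith)]
    exact max_le (by linarith) (by linarith)
  have h2 : |(1 + r) - (1 - r)| = 2 * r := by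
    rw [show (1 + r) - (1 - r) = 2 * r by ring, abs_of_pos (by linarith)]
  rw [h2] at hpow
  have hpow2 : 2 * r * D * max |1 + r| |1 - r| ^ (D - 1) ≤ 2 * r * D * 2 ^ (D - 1) := by gcongr
  obtain ⟨m, hm⟩ : ∃ m, D = m + 1 := ⟨D - 1, by omega⟩
  rw [hm] at hμ hpow hpow2 ⊢
  simp only [Nat.add_sub_cancel] at hμ hpow hpow2 ⊢
  have : r * (s.card * r ^ m) ≤ r * ((m + 1 : ℕ) * 2 ^ (m + 1)) := by
    rw [pow_succ r, pow_succ (2 : ℝ)] at *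
    linarith
  exact le_of_mul_le_mul_left this hr

open Metric Module in
theorem packingNumber_le_of_subset_sphere {E : Type*} [NormedAddCommGroup E] [NormedSpace ℝ E]
    [FiniteDimensional ℝ E] [Nontrivial E] {A : Set E} (hA : A ⊆ sphere 0 1) (k : ℕ) :
    packingNumber ((1 / 2) ^ k) A ≤
      ((finrank ℝ E * 2 ^ (2 * finrank ℝ E) * (2 ^ (finrank ℝ E - 1)) ^ k : ℕ) : ℕ∞) := by
  set D := finrank ℝ E with hD
  have hDpos : 0 < D := finrank_pos
  simp only [packingNumber, iSup_le_iff]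
  intro s hsA hsep
  by_contra! hlt
  obtain ⟨t, hts, ht⟩ := exists_subset_encard_eq (Order.add_one_le_of_lt hlt)
  have htfin : t.Finite := by
    rw [← encard_lt_top_iff, ht]
    exact_mod_cast ENat.natCast_lt_top _
  lift t to Finset E using htfin
  rw [encard_coe_eq_coe_finsetCard] at ht
  have hcard : t.card = D * 2 ^ (2 * D) * (2 ^ (D - 1)) ^ k + 1 := by exact_mod_cast ht
  have hle := card_mul_pow_le_of_separated_sphere (s := t) (r := (1 / 2) ^ k / 2)
    (hts.trans (hsA.trans hA)) (by positivity)
    (by linarith [pow_le_one₀ (n := k) (by norm_num : (0 : ℝ) ≤ 1 / 2) (by norm_num)])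
    (fun x hx y hy hxy ↦ by
      have : (((1 / 2) ^ k : NNReal) : ENNReal) < edist x y := hsep (hts hx) (hts hy) hxy
      rw [edist_nndist, ENNReal.coe_lt_coe, ← NNReal.coe_lt_coe] at this
      push_cast at this
      linarith)
  rw [← hD, hcard] at hle
  obtain ⟨m, hm⟩ : ∃ m, D = m + 1 := ⟨D - 1, by omega⟩
  rw [hm] at hle
  simp only [Nat.add_sub_cancel] at hle
  have hinv : ((2 : ℝ) ^ m) ^ k * ((1 / 2) ^ k / 2) ^ m = 1 / 2 ^ m := by
    rw [div_pow, ← pow_mul, ← pow_mul, mul_comm k m, one_div_pow, ← mul_div_assoc,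
      mul_one_div_cancel (by positivity)]
  have hexp : (2 : ℝ) ^ (2 * (m + 1)) * (1 / 2 ^ m) = 2 ^ (m + 1) * 2 := by
    rw [show 2 * (m + 1) = m + (m + 2) by ring, pow_add]
    field_simp
    ring
  have hpos : 0 < ((1 / 2 : ℝ) ^ k / 2) ^ m := by positivity
  have hge : 0 < ((m + 1 : ℕ) : ℝ) * 2 ^ (m + 1) := by positivity
  have : (((m + 1) * 2 ^ (2 * (m + 1)) * (2 ^ m) ^ k + 1 : ℕ) : ℝ) * ((1 / 2) ^ k / 2) ^ m
      = ((m + 1 : ℕ) : ℝ) * 2 ^ (m + 1) * 2 + ((1 / 2 : ℝ) ^ k / 2) ^ m := by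
    rw [mul_assoc ((m + 1 : ℕ) : ℝ), ← hexp, ← hinv]
    push_cast
    ring
  linarith

open Metric in
theorem exists_enumerated_net {X : Type*} [PseudoMetricSpace X] {A : Set X} (hA : A.Nonempty)
    {ε : NNReal} {N : ℕ} (h : packingNumber ε A ≤ N) :
    ∃ f : ℕ → X, (∀ i, f i ∈ A) ∧ ∀ x ∈ A, ∃ i < N, dist x (f i) ≤ ε := by
  have htop : coveringNumber ε A ≠ ⊤ :=
    (((coveringNumber_le_packingNumber ε A).trans h).trans_lt (ENat.natCast_lt_top N)).ne
  obtain ⟨c, hcA, hcfin, hcov, hcard⟩ := exists_set_encard_eq_coveringNumber htop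
  obtain ⟨a, ha⟩ := hA
  lift c to Finset X using hcfin
  have hcN : c.card ≤ N := by
    have := hcard.le.trans ((coveringNumber_le_packingNumber ε A).trans h)
    rw [encard_coe_eq_coe_finsetCard] at this
    exact_mod_cast this
  refine ⟨fun i ↦ if hi : i < c.card then c.equivFin.symm ⟨i, hi⟩ else a, fun i ↦ ?_,
    fun x hx ↦ ?_⟩
  · dsimp only
    split_ifs with hi
    · exact hcA (c.equivFin.symm ⟨i, hi⟩).2
    · exact ha
  · obtain ⟨y, hy, hxy⟩ := hcov hx
    refine ⟨c.equivFin ⟨y, hy⟩, (c.equivFin ⟨y, hy⟩).2.trans_le hcN, ?_⟩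
    have hxy' : edist x y ≤ ε := hxy
    rw [edist_nndist, ENNReal.coe_le_coe, ← NNReal.coe_le_coe, coe_nndist] at hxy'
    simpa using hxy'

/-- Concatenating nets of mesh `2⁻ᵏ` and cardinality `M * (2 ^ m) ^ k` produces a sequence
approximating each point at rate `n ^ (-1 / m)`. -/
theorem exists_seq_approx_of_nets {X : Type*} [PseudoMetricSpace X] {A : Set X} {m M : ℕ}
    (hm : 1 ≤ m) (hM : 1 ≤ M) (hdiam : ∀ x ∈ A, ∀ y ∈ A, dist x y ≤ 2) (f : ℕ → ℕ → X)
    (hfA : ∀ k i, f k i ∈ A)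
    (hf : ∀ k, ∀ x ∈ A, ∃ i < M * (2 ^ m) ^ k, dist x (f k i) ≤ (1 / 2) ^ k) :
    ∃ K : ℝ, 0 < K ∧ ∃ u : ℕ → X, (∀ n, u n ∈ A) ∧
      ∀ x ∈ A, ∃ p : ℕ → ℕ, Tendsto p atTop atTop ∧
        ∀ n : ℕ, 1 ≤ n → 1 ≤ p n ∧ p n ≤ n ∧
          dist x (u (p n)) ≤ K / (n : ℝ) ^ ((1 : ℝ) / m) := by
  set b := 2 ^ m with hb
  have hb2 : 2 ≤ b := by simpa using Nat.pow_le_pow_right (n := 2) (by norm_num) hm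
  have hdouble : ∀ k, 2 * (M * b ^ k) ≤ M * b ^ (k + 1) := fun k ↦ by
    rw [pow_succ, mul_comm 2, mul_assoc]
    gcongr
  have hNpos : ∀ k, 1 ≤ M * b ^ k := fun k ↦ Nat.mul_pos hM (by positivity)
  have hlog : ∀ k i, i < M * b ^ k → Nat.log b ((M * b ^ k + i) / M) = k := fun k i hi ↦ by
    apply Nat.log_eq_of_pow_le_of_lt_pow
    · rw [Nat.le_div_iff_mul_le hM, mul_comm _ M]
      omega
    · rw [Nat.div_lt_iff_lt_mul hM, mul_comm _ M]
      have := hdouble k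
      omega
  have hroot : ∀ n k : ℕ, n ≤ M * b ^ k → (n : ℝ) ^ ((1 : ℝ) / m) ≤ M * 2 ^ k := fun n k h ↦ by
    have h1 : n ≤ (M * 2 ^ k) ^ m := h.trans (by
      rw [mul_pow, hb, ← pow_mul, ← pow_mul, mul_comm k m]
      exact Nat.mul_le_mul_right _ (Nat.le_self_pow (by omega) M))
    have h2 : (n : ℝ) ≤ ((M : ℝ) * 2 ^ k) ^ m := by exact_mod_cast h1
    calc (n : ℝ) ^ ((1 : ℝ) / m) ≤ (((M : ℝ) * 2 ^ k) ^ m) ^ ((1 : ℝ) / m) := by gcongr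
      _ = M * 2 ^ k := by
        rw [one_div]
        exact Real.pow_rpow_inv_natCast (by positivity) (by omega)
  refine ⟨4 * M, by positivity,
    fun j ↦ f (Nat.log b (j / M)) (j - M * b ^ Nat.log b (j / M)), fun n ↦ hfA _ _,
    fun x hx ↦ ?_⟩
  choose i hi hxi using fun k ↦ hf k x hx
  let L : ℕ → ℕ := fun n ↦ Nat.log b (n / M)
  let p : ℕ → ℕ := fun n ↦ if L n = 0 then 1 else M * b ^ (L n - 1) + i (L n - 1)
  have hLtop : Tendsto L atTop atTop := by
    refine tendsto_atTop.2 fun k ↦ ?_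
    filter_upwards [eventually_ge_atTop (M * b ^ k)] with n hn
    apply Nat.le_log_of_pow_le (by omega)
    rwa [Nat.le_div_iff_mul_le hM, mul_comm]
  have hltL : ∀ n, n ≤ M * b ^ (L n + 1) := fun n ↦ by
    have := Nat.lt_pow_succ_log_self (b := b) (by omega) (n / M)
    rw [Nat.div_lt_iff_lt_mul hM, mul_comm] at this
    exact this.le
  refine ⟨p, ?_, fun n hn ↦ ?_⟩
  · refine tendsto_atTop_mono (fun n ↦ ?_) hLtop
    dsimp only [p]
    split_ifs with h
    · omega
    · have h1 : L n - 1 < b ^ (L n - 1) := Nat.lt_pow_self (by omega)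
      have h2 : b ^ (L n - 1) ≤ M * b ^ (L n - 1) := Nat.le_mul_of_pos_left _ hM
      omega
  · have hnpos : (0 : ℝ) < (n : ℝ) ^ ((1 : ℝ) / m) := by
      have : (0 : ℝ) < n := by exact_mod_cast hn
      positivity
    have hr := hroot n _ (hltL n)
    by_cases h : L n = 0
    · have hp : p n = 1 := if_pos h
      rw [hp]
      refine ⟨le_rfl, hn, (hdiam x hx _ (hfA _ _)).trans ?_⟩
      rw [le_div_iff₀ hnpos]
      rw [h] at hr
      linarith
    · obtain ⟨k, hk⟩ := Nat.exists_eq_succ_of_ne_zero h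
      have hp : p n = M * b ^ k + i k := by simp [p, hk]
      have hle : M * b ^ (k + 1) ≤ n := by
        have hne : n / M ≠ 0 := fun h0 ↦ h (by simp [L, h0])
        have := Nat.pow_log_le_self b hne
        rw [Nat.le_div_iff_mul_le hM, mul_comm, show Nat.log b (n / M) = k + 1 from hk] at this
        exact this
      have := hdouble k
      have := hi k
      have := hNpos k
      rw [hp]
      refine ⟨by omega, by omega, ?_⟩
      beta_reduce
      rw [hlog k _ (hi k), Nat.add_sub_cancel_left]
      refine (hxi k).trans ?_
      rw [le_div_iff₀ hnpos]
      rw [hk] at hr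
      calc (1 / 2 : ℝ) ^ k * (n : ℝ) ^ ((1 : ℝ) / m)
          ≤ (1 / 2 : ℝ) ^ k * (M * 2 ^ (k.succ + 1)) := by gcongr
        _ = 4 * M * ((1 / 2) ^ k * 2 ^ k) := by rw [Nat.succ_eq_add_one]; ring
        _ = 4 * M := by rw [← mul_pow]; norm_num

open Module in
theorem exists_norm_eq_one_mem_ker {E : Type*} [NormedAddCommGroup E] [NormedSpace ℝ E]
    [FiniteDimensional ℝ E] (hE : 2 ≤ finrank ℝ E) (f : E →ₗ[ℝ] ℝ) :
    ∃ x ∈ LinearMap.ker f, ‖x‖ = 1 := by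
  have hker : LinearMap.ker f ≠ ⊥ := LinearMap.ker_ne_bot_of_finrank_lt (by rwa [finrank_self])
  obtain ⟨v, hv, hv0⟩ := Submodule.exists_mem_ne_zero_of_ne_bot hker
  exact ⟨(‖v‖⁻¹ : ℝ) • v, Submodule.smul_mem _ _ hv, norm_smul_inv_norm (𝕜 := ℝ) hv0⟩

theorem stmt5 (d : ℕ) (hd : 2 ≤ d)
    (H : Set (EuclideanSpace ℝ (Fin d))) (hne : H.Nonempty) (hcl : IsClosed H)
    (hyperplanes : ∃ 𝔉 : Set (EuclideanSpace ℝ (Fin d) →ₗ[ℝ] ℝ),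
      (∀ f ∈ 𝔉, f ≠ 0) ∧ H = ⋃ f ∈ 𝔉, (LinearMap.ker f : Set (EuclideanSpace ℝ (Fin d))))
    (C : Set (EuclideanSpace ℝ (Fin d)))
    (hC : C = Metric.sphere (0 : EuclideanSpace ℝ (Fin d)) 1 ∩ H) :
    ∃ K : ℝ, 0 < K ∧ ∃ u : ℕ → EuclideanSpace ℝ (Fin d), (∀ n, u n ∈ C) ∧
      ∀ x ∈ C, ∃ p : ℕ → ℕ, Tendsto p atTop atTop ∧
        ∀ n : ℕ, 1 ≤ n → 1 ≤ p n ∧ p n ≤ n ∧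
          ‖x - u (p n)‖ ≤ K / (n : ℝ) ^ ((1 : ℝ) / ((d : ℝ) - 1)) := by
  have hfr : Module.finrank ℝ (EuclideanSpace ℝ (Fin d)) = d := by simp
  have : Nontrivial (EuclideanSpace ℝ (Fin d)) :=
    Module.nontrivial_of_finrank_pos (R := ℝ) (by omega)
  have hCsphere : C ⊆ Metric.sphere 0 1 := hC ▸ inter_subset_left
  have hCne : C.Nonempty := by
    obtain ⟨𝔉, -, rfl⟩ := hyperplanes
    obtain ⟨y, hy⟩ := hne
    simp only [mem_iUnion] at hy
    obtain ⟨f, hf, -⟩ := hy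
    obtain ⟨x, hx, hx1⟩ := exists_norm_eq_one_mem_ker (hfr.symm ▸ hd) f
    exact ⟨x, hC ▸ ⟨by simpa using hx1, mem_biUnion hf hx⟩⟩
  choose f hfC hf using fun k ↦
    exists_enumerated_net hCne (packingNumber_le_of_subset_sphere hCsphere k)
  rw [hfr] at hf
  have hdiam : ∀ x ∈ C, ∀ y ∈ C, dist x y ≤ 2 := fun x hx y hy ↦ by
    have h1 := hCsphere hx
    have h2 := hCsphere hy
    rw [Metric.mem_sphere] at h1 h2
    linarith [dist_triangle_right x y 0]
  obtain ⟨K, hK, u, hu, h⟩ := exists_seq_approx_of_nets (m := d - 1) (M := d * 2 ^ (2 * d))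
    (by omega) (Nat.mul_pos (by omega) (by positivity)) hdiam f hfC
    (fun k x hx ↦ by simpa using hf k x hx)
  rw [Nat.cast_sub (by omega), Nat.cast_one] at h
  exact ⟨K, hK, u, hu, by simpa only [dist_eq_norm] using h⟩
end

section
/- Let X be a complex Banach space, let (e_k)_{k≥1} be a sequence in X with ‖e_k‖ = 1 whose linear span is dense in X, and let (e_k*) be continuous linear functionals on X with ⟨e_n*, e_m⟩ = δ_{n,m} and K := sup_k ‖e_k*‖ < ∞. Let (m_k)_{k≥1} be positive integers with m_1 = m_2 (arbitrary), m_k dividing m_{k+1} for all k, and ∑_{k≥3} m_{k-1}/m_k < ∞. Set λ_1 = λ_2 = 1 and λ_k = e^{iπ/m_k} for k ≥ 3. If S is a bounded linear operator on X satisfying S e_k = λ_k e_k for all k, then for every x ∈ X, S^{2 m_n} x → x as n → ∞. -/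
open Filter Topology Set

/-- An operator that is diagonal on a normalised, bounded, fundamental biorthogonal system has norm
at most `K` times the sum of the moduli of its eigenvalues. -/
theorem opNorm_le_of_diagonal {ι X : Type*} [NormedAddCommGroup X] [NormedSpace ℂ X]
    [CompleteSpace X] {e : ι → X} {f : ι → X →L[ℂ] ℂ} {K : ℝ} (he : ∀ i, ‖e i‖ = 1)
    (hdense : Dense (Submodule.span ℂ (range e) : Set X)) (hself : ∀ i, f i (e i) = 1)
    (hne : ∀ i j, i ≠ j → f i (e j) = 0) (hf : ∀ i, ‖f i‖ ≤ K) {T : X →L[ℂ] X} {μ : ι → ℂ}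
    (hT : ∀ i, T (e i) = μ i • e i) (hμ : Summable fun i => ‖μ i‖) :
    ‖T‖ ≤ K * ∑' i, ‖μ i‖ := by
  have hbound : ∀ i, ‖μ i • (f i).smulRight (e i)‖ ≤ K * ‖μ i‖ := fun i => by
    rw [norm_smul, ContinuousLinearMap.norm_smulRight_apply, he, mul_one, mul_comm]
    exact mul_le_mul_of_nonneg_right (hf i) (norm_nonneg _)
  have hsummable : Summable fun i => μ i • (f i).smulRight (e i) :=
    (hμ.mul_left K).of_norm_bounded hbound
  have hTeq : T = ∑' i, μ i • (f i).smulRight (e i) := by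
    refine ContinuousLinearMap.ext_on hdense ?_
    rintro _ ⟨j, rfl⟩
    have happly := (ContinuousLinearMap.apply ℂ X (e j)).map_tsum hsummable
    simp only [ContinuousLinearMap.apply_apply] at happly
    rw [happly, tsum_eq_single j fun i hij => by simp [hne i j hij]]
    simp [hT, hself]
  rw [hTeq, ← tsum_mul_left]
  exact tsum_of_norm_bounded (hμ.mul_left K).hasSum hbound

theorem norm_exp_pi_div_pow_sub_one_le (a t : ℕ) :
    ‖Complex.exp (Real.pi * Complex.I / a) ^ (2 * t) - 1‖ ≤ 2 * Real.pi * (t / a) := by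
  have hexp : Complex.exp (Real.pi * Complex.I / a) ^ (2 * t) =
      Complex.exp (Complex.I * ((2 * Real.pi * (t / a) : ℝ) : ℂ)) := by
    rw [← Complex.exp_nat_mul]
    congr 1
    push_cast
    ring
  rw [hexp]
  refine Real.norm_exp_I_mul_ofReal_sub_one_le.trans_eq ?_
  exact Real.norm_of_nonneg (by positivity)

theorem exp_pi_div_pow_eq_one {a t : ℕ} (ha : 0 < a) (h : a ∣ t) :
    Complex.exp (Real.pi * Complex.I / a) ^ (2 * t) = 1 := by
  obtain ⟨c, rfl⟩ := h
  have ha' : (a : ℂ) ≠ 0 := by exact_mod_cast ha.ne'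
  rw [← Complex.exp_nat_mul, Complex.exp_eq_one_iff]
  refine ⟨c, ?_⟩
  push_cast
  field_simp

theorem stmt6 (X : Type*) [NormedAddCommGroup X] [NormedSpace ℂ X] [CompleteSpace X]
    (e : ℕ → X) (estar : ℕ → (X →L[ℂ] ℂ)) (K : ℝ)
    (henorm : ∀ k, 1 ≤ k → ‖e k‖ = 1)
    (hdense : Dense (↑(Submodule.span ℂ (e '' {k | 1 ≤ k})) : Set X))
    (hdual : ∀ n m : ℕ, 1 ≤ n → 1 ≤ m → estar n (e m) = if n = m then 1 else 0)
    (hKlt : ∀ k, 1 ≤ k → ‖estar k‖ ≤ K)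
    (m : ℕ → ℕ) (hmpos : ∀ k, 1 ≤ k → 0 < m k)
    (hdvd : ∀ k, 1 ≤ k → m k ∣ m (k + 1))
    (hsum : Summable (fun k : ℕ => (m (k + 2) : ℝ) / m (k + 3)))
    (lam : ℕ → ℂ) (hlam1 : lam 1 = 1) (hlam2 : lam 2 = 1)
    (hlam : ∀ k, 3 ≤ k → lam k = Complex.exp (Real.pi * Complex.I / m k))
    (S : X →L[ℂ] X) (hS : ∀ k, 1 ≤ k → S (e k) = lam k • e k) :
    ∀ x : X, Tendsto (fun n : ℕ => (S ^ (2 * m n)) x) atTop (𝓝 x) := by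
  have hdvd_le : ∀ {j n : ℕ}, 1 ≤ j → j ≤ n → m j ∣ m n := by
    intro j n hj hjn
    induction n, hjn using Nat.le_induction with
    | base => exact dvd_rfl
    | succ n hn ih => exact ih.trans (hdvd n (hj.trans hn))
  have hone : ∀ k n, k + 1 ≤ n → lam (k + 1) ^ (2 * m n) - 1 = 0 := by
    intro k n hkn
    match k with
    | 0 => simp [hlam1]
    | 1 => simp [hlam2]
    | k + 2 =>
      rw [hlam _ (by lia), exp_pi_div_pow_eq_one (hmpos _ (by lia)) (hdvd_le (by lia) hkn),
        sub_self]
  have hle : ∀ n, 2 ≤ n → ∀ k,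
      ‖lam (k + 1) ^ (2 * m n) - 1‖ ≤ 2 * Real.pi * (m k / m (k + 1)) := by
    intro n hn k
    rcases le_or_gt (k + 1) n with hkn | hkn
    · rw [hone k n hkn, norm_zero]
      positivity
    · rw [hlam _ (by lia)]
      refine (norm_exp_pi_div_pow_sub_one_le _ _).trans ?_
      have hmle : m n ≤ m k := Nat.le_of_dvd (hmpos _ (by lia)) (hdvd_le (by lia) (by lia))
      gcongr
  have hsummable : Summable fun k : ℕ => 2 * Real.pi * ((m k : ℝ) / m (k + 1)) :=
    ((summable_nat_add_iff (f := fun k : ℕ => (m k : ℝ) / m (k + 1)) 2).mp hsum).mul_left _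
  have hpow : ∀ n k, (S ^ (2 * m n) - 1) (e (k + 1)) =
      (lam (k + 1) ^ (2 * m n) - 1) • e (k + 1) := by
    intro n k
    have hiter : ∀ t : ℕ, (S ^ t) (e (k + 1)) = lam (k + 1) ^ t • e (k + 1) := by
      intro t
      induction t with
      | zero => simp
      | succ t ih =>
        rw [pow_succ, mul_apply_eq_comp, hS _ (by lia), map_smul, ih, smul_smul,
          pow_succ']
    simp [hiter, sub_smul]
  have hrange : range (fun k => e (k + 1)) = e '' {k | 1 ≤ k} := by
    ext x
    constructor
    · rintro ⟨k, rfl⟩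
      exact ⟨k + 1, by simp, rfl⟩
    · rintro ⟨k, hk, rfl⟩
      exact ⟨k - 1, by simp [Nat.sub_add_cancel hk]⟩
  have hnorm : ∀ᶠ n in atTop,
      ‖S ^ (2 * m n) - 1‖ ≤ K * ∑' k, ‖lam (k + 1) ^ (2 * m n) - 1‖ := by
    filter_upwards [eventually_ge_atTop 2] with n hn
    refine opNorm_le_of_diagonal (e := fun k => e (k + 1)) (f := fun k => estar (k + 1))
      (fun k => henorm _ (by lia)) (by rwa [hrange]) (fun k => ?_) (fun i j hij => ?_)
      (fun k => hKlt _ (by lia)) (hpow n) ?_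
    · simp [hdual]
    · simp [hdual, hij]
    · exact hsummable.of_nonneg_of_le (fun _ => norm_nonneg _) (hle n hn)
  have htsum : Tendsto (fun n => K * ∑' k, ‖lam (k + 1) ^ (2 * m n) - 1‖) atTop (𝓝 0) := by
    have hdom := tendsto_tsum_of_dominated_convergence
      (f := fun n k => ‖lam (k + 1) ^ (2 * m n) - 1‖) (g := fun _ => (0 : ℝ)) (𝓕 := atTop)
      hsummable (fun k => tendsto_const_nhds.congr' ?_) ?_
    · simpa using hdom.const_mul K
    · filter_upwards [eventually_ge_atTop (k + 1)] with n hn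
      simp [hone k n hn]
    · filter_upwards [eventually_ge_atTop 2] with n hn k
      simpa using hle n hn k
  have hS_tendsto : Tendsto (fun n => S ^ (2 * m n)) atTop (𝓝 1) :=
    tendsto_iff_norm_sub_tendsto_zero.mpr
      (squeeze_zero' (Eventually.of_forall fun _ => norm_nonneg _) hnorm htsum)
  intro x
  exact ((ContinuousLinearMap.apply ℂ X x).continuous.tendsto 1).comp hS_tendsto
end

section
/- Let X be a complex Banach space, (e_k)_{k≥1} a sequence in X with ‖e_k‖ = 1 and dense linear span, and (e_k*) continuous linear functionals with ⟨e_n*, e_m⟩ = δ_{n,m} and sup_k ‖e_k*‖ < ∞. Let P be the continuous projection Px = ⟨e_1*, x⟩ e_1 + ⟨e_2*, x⟩ e_2. Let (m_k) be positive integers with m_k | m_{k+1}, set λ_1 = λ_2 = 1 and λ_k = e^{iπ/m_k} for k ≥ 3, and let S be a bounded operator on X with S e_k = λ_k e_k for all k. Let (f_k)_{k≥3} be continuous linear forms on X with ∑_{k≥3} ‖f_k‖/m_{k−1} < ∞, each f_k vanishing on the kernel of P (i.e., f_k = f_k ∘ P), and define the bounded operator R by Rx = Sx + ∑_{k≥3}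 (1/m_{k−1}) f_k(Px) e_k. Then for every x ∈ X and every integer t ≥ 1, R^t x = S^t x + ∑_{k≥3} (λ_{k,t}/m_{k−1}) f_k(Px) e_k, where λ_{k,t} = ∑_{l=0}^{t−1} λ_k^l. -/
open Filter Topology Set

theorem ContinuousLinearMap.pow_apply_smul_of_eigen {X : Type*} [NormedAddCommGroup X]
    [NormedSpace ℂ X] (S : X →L[ℂ] X) {v : X} {μ : ℂ} (hv : S v = μ • v) (t : ℕ) (c : ℂ) :
    (S ^ t) (c • v) = (μ ^ t * c) • v := by
  induction t with
  | zero => simp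
  | succ t ih =>
    rw [pow_succ', mul_apply_eq_comp, ih, map_smul, hv, smul_smul]
    congr 1
    ring

theorem stmt7 (X : Type*) [NormedAddCommGroup X] [NormedSpace ℂ X] [CompleteSpace X]
    (e : ℕ → X) (estar : ℕ → (X →L[ℂ] ℂ)) (K : ℝ)
    (henorm : ∀ k, 1 ≤ k → ‖e k‖ = 1)
    (hdense : Dense (↑(Submodule.span ℂ (e '' {k | 1 ≤ k})) : Set X))
    (hdual : ∀ n m : ℕ, 1 ≤ n → 1 ≤ m → estar n (e m) = if n = m then 1 else 0)
    (hKlt : ∀ k, 1 ≤ k → ‖estar k‖ ≤ K)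
    (P : X →L[ℂ] X) (hP : ∀ x, P x = estar 1 x • e 1 + estar 2 x • e 2)
    (m : ℕ → ℕ) (hmpos : ∀ k, 1 ≤ k → 0 < m k)
    (hdvd : ∀ k, 1 ≤ k → m k ∣ m (k + 1))
    (lam : ℕ → ℂ) (hlam1 : lam 1 = 1) (hlam2 : lam 2 = 1)
    (hlam : ∀ k, 3 ≤ k → lam k = Complex.exp (Real.pi * Complex.I / m k))
    (S : X →L[ℂ] X) (hS : ∀ k, 1 ≤ k → S (e k) = lam k • e k)
    (f : ℕ → (X →L[ℂ] ℂ))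
    (hfsum : Summable (fun k : ℕ => ‖f (k + 3)‖ / (m (k + 2) : ℝ)))
    (hfP : ∀ k, 3 ≤ k → ∀ x, f k (P x) = f k x)
    (R : X →L[ℂ] X)
    (hR : ∀ x, R x = S x +
      ∑' k : ℕ, ((1 / (m (k + 2) : ℂ)) * f (k + 3) (P x)) • e (k + 3)) :
    ∀ x : X, ∀ t : ℕ, 1 ≤ t →
      (R ^ t) x = (S ^ t) x +
        ∑' k : ℕ, (((∑ l ∈ Finset.range t, lam (k + 3) ^ l) / (m (k + 2) : ℂ)) *
          f (k + 3) (P x)) • e (k + 3) := by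
  have hPe : ∀ k, P (e (k + 3)) = 0 := fun k ↦ by
    rw [hP, hdual 1 (k + 3) (by omega) (by omega), hdual 2 (k + 3) (by omega) (by omega)]
    simp
  have hPS : P.comp S = P := by
    refine ContinuousLinearMap.ext_on hdense ?_
    rintro _ ⟨k, hk, rfl⟩
    have hk : 1 ≤ k := hk
    rw [ContinuousLinearMap.comp_apply, hS k hk, map_smul]
    obtain rfl | rfl | h3 : k = 1 ∨ k = 2 ∨ 3 ≤ k := by omega
    · rw [hlam1, one_smul]
    · rw [hlam2, one_smul]
    · obtain ⟨j, rfl⟩ := Nat.exists_eq_add_of_le' h3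
      rw [hPe, smul_zero]
  have hsum : ∀ x, Summable fun k : ℕ ↦
      ((1 / (m (k + 2) : ℂ)) * f (k + 3) (P x)) • e (k + 3) := fun x ↦ by
    refine Summable.of_norm_bounded (hfsum.mul_right ‖P x‖) fun k ↦ ?_
    rw [norm_smul, henorm _ (by omega), mul_one, norm_mul, norm_div, norm_one,
      Complex.norm_natCast, div_mul_eq_mul_div, div_mul_eq_mul_div, one_mul]
    gcongr
    exact (f (k + 3)).le_opNorm _
  have hPR : ∀ x, P (R x) = P x := fun x ↦ by
    rw [hR, map_add, P.map_tsum (hsum x), ← ContinuousLinearMap.comp_apply, hPS]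
    simp [hPe]
  have hpow : ∀ (t : ℕ) (x : X) (k : ℕ),
      (S ^ t) (((1 / (m (k + 2) : ℂ)) * f (k + 3) (P x)) • e (k + 3)) =
        (lam (k + 3) ^ t * ((1 / (m (k + 2) : ℂ)) * f (k + 3) (P x))) • e (k + 3) :=
    fun t x k ↦ S.pow_apply_smul_of_eigen (hS _ (by omega)) t _
  have hsum_pow : ∀ (t : ℕ) (x : X), Summable fun k : ℕ ↦
      (((∑ l ∈ Finset.range t, lam (k + 3) ^ l) / (m (k + 2) : ℂ)) *
        f (k + 3) (P x)) • e (k + 3) := fun t x ↦ by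
    refine (summable_sum (s := Finset.range t) fun l _ ↦
      (hsum x).mapL (S ^ l)).congr fun k ↦ ?_
    simp only [hpow, ← Finset.sum_smul, ← Finset.sum_mul]
    congr 1
    ring
  rintro x t -
  induction t generalizing x with
  | zero => simp
  | succ t ih =>
    rw [pow_succ R, mul_apply_eq_comp, ih (R x), hPR, hR, map_add,
      (S ^ t).map_tsum (hsum x), pow_succ S, mul_apply_eq_comp, add_assoc,
      ← ((hsum x).mapL (S ^ t)).tsum_add (hsum_pow t x)]
    congr 1
    refine tsum_congr fun k ↦ ?_
    rw [hpow, ← add_smul, Finset.sum_range_succ]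
    congr 1
    ring
end

section
/- Let m ≥ 1 and H ≥ 4m be integers, and let ‖·‖ be a norm on ℝ^H (coordinates indexed by {1,…,H}) which is symmetric: for every permutation π of {1,…,H} and every x, ‖(x_{π(1)},…,x_{π(H)})‖ = ‖(|x_1|,…,|x_H|)‖ = ‖x‖, and whenever 0 ≤ x_i ≤ y_i for all i one has ‖x‖ ≤ ‖y‖. Let S be the cyclic shift operator S e_i = e_{i+1} (indices mod H, with S e_H = e_1), let w = ∑_{i=1}^m e_i − ∑_{i=m+1}^{2m} e_i, and w_t = (I + S + ⋯ + S^{t−1}) w for t ≥ 1. Then: (i) w_H = 0 and w_{t+H} = w_t for all t ≥ 1; and (ii) for every t with 2m ≤ t ≤ H − 2m, ‖w_t‖ ≥ (m/2)‖w‖ and ‖w_s‖ ≤ ‖w_t‖ for every s ≥ 1. -/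
open Filter Topology

/-- A permutation-invariant, absolute, monotone functional on `Fin H → ℝ` increases when the nonzero
entries are moved injectively to positions carrying entries at least as large in modulus. -/
theorem symmetric_le_of_injOn {H : ℕ} {N : (Fin H → ℝ) → ℝ}
    (hNperm : ∀ (π : Equiv.Perm (Fin H)) (x : Fin H → ℝ), N (fun i => x (π i)) = N x)
    (hNabs : ∀ x : Fin H → ℝ, N (fun i => |x i|) = N x)
    (hNmono : ∀ x y : Fin H → ℝ, (∀ i, 0 ≤ x i) → (∀ i, x i ≤ y i) → N x ≤ N y)
    {x y : Fin H → ℝ} (f : Fin H → Fin H) (hf : Set.InjOn f {i | x i ≠ 0})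
    (hxy : ∀ i, x i ≠ 0 → |x i| ≤ |y (f i)|) : N x ≤ N y := by
  classical
  obtain ⟨g, hg⟩ := Set.MapsTo.exists_equiv_extend_of_card_eq (t := (Finset.univ : Finset (Fin H)))
    (by simp) (fun i _ => by simp) hf
  let π : Equiv.Perm (Fin H) := g.trans (Equiv.subtypeUnivEquiv fun i => Finset.mem_univ i)
  have hπ : ∀ i, x i ≠ 0 → π i = f i := fun i hi => hg i hi
  rw [← hNabs x, ← hNabs y, ← hNperm π fun i => |y i|]
  refine hNmono _ _ (fun i => abs_nonneg _) fun i => ?_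
  by_cases hi : x i = 0
  · simp [hi]
  · simpa [hπ i hi] using hxy i hi

theorem val_finRotate_pow {H : ℕ} (t : ℕ) (k : Fin H) (h : (k : ℕ) + t < H) :
    ((finRotate H ^ t) k : ℕ) = k + t := by
  induction t with
  | zero => simp
  | succ t ih =>
    have ih := ih (by lia)
    obtain ⟨n, rfl⟩ : ∃ n, H = n + 1 := ⟨H - 1, by lia⟩
    rw [pow_succ', Equiv.Perm.mul_apply, coe_finRotate_of_ne_last, ih, add_assoc]
    intro hl
    have := congrArg Fin.val hl
    simp only [Fin.val_last] at this
    lia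

theorem finRotate_pow_self (H : ℕ) : finRotate H ^ H = 1 := by
  ext k
  have hk := k.isLt
  obtain ⟨n, rfl⟩ : ∃ n, H = n + 1 := ⟨H - 1, by lia⟩
  have h₀ : (finRotate (n + 1) ^ (k : ℕ)) 0 = k := by
    ext
    rw [val_finRotate_pow _ _ (by simp [hk])]
    simp
  have h₁ : (finRotate (n + 1) ^ (n + 1)) 0 = 0 := by
    have : (finRotate (n + 1) ^ n) 0 = Fin.last n := by
      ext
      rw [val_finRotate_pow _ _ (by simp)]
      simp
    rw [pow_succ', Equiv.Perm.mul_apply, this, finRotate_last]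
  rw [← h₀, ← Equiv.Perm.mul_apply, (Commute.refl (finRotate (n + 1))).pow_pow (n + 1) k |>.eq,
    Equiv.Perm.mul_apply, h₁, Equiv.Perm.one_apply]

/-- The tent with peak `m` at position `m - 1`, supported on the positions below `2 * m - 1`. -/
def tent (m i : ℕ) : ℝ := ((min (i + 1) (2 * m - 1 - i) : ℕ) : ℝ)

theorem tent_nonneg (m i : ℕ) : 0 ≤ tent m i := Nat.cast_nonneg _

theorem tent_eq_zero {m i : ℕ} (h : 2 * m ≤ i + 1) : tent m i = 0 := by
  simp only [tent, Nat.cast_eq_zero]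
  lia

theorem half_le_tent {m i : ℕ} (h : i < m) : (m : ℝ) / 2 ≤ tent m (i + (m - 1) / 2) := by
  rw [tent, div_le_iff₀ two_pos]
  norm_cast
  lia

theorem tent_sub_tent (m i : ℕ) :
    tent m (i + 1) - tent m i =
      if i + 1 < m then 1 else if i + 1 < 2 * m then -1 else 0 := by
  rw [sub_eq_iff_eq_add]
  simp only [tent]
  split_ifs
  · norm_cast
    lia
  · rw [neg_add_eq_sub, eq_sub_iff_add_eq]
    norm_cast
    lia
  · norm_cast
    lia

theorem tent_sub_tent_finRotate {m H : ℕ} (hm : 1 ≤ m) (hH : 2 * m ≤ H) (i : Fin H) :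
    tent m i - tent m ((finRotate H).symm i) =
      if (i : ℕ) < m then 1 else if (i : ℕ) < 2 * m then -1 else 0 := by
  obtain ⟨n, rfl⟩ : ∃ n, H = n + 1 := ⟨H - 1, by lia⟩
  obtain ⟨k, rfl⟩ := (finRotate (n + 1)).surjective i
  rw [Equiv.symm_apply_apply]
  by_cases hk : k = Fin.last n
  · subst hk
    rw [finRotate_last, tent_eq_zero (i := (Fin.last n : ℕ)) (by simpa using hH)]
    have : min 1 (2 * m - 1) = 1 := by lia
    simp [tent, this, show 0 < m by lia]
  · rw [coe_finRotate_of_ne_last hk]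
    exact tent_sub_tent m k

theorem tent_sub_tent_finRotate_pow_inr {m H t : ℕ} (h2 : 2 * m ≤ t) (ht : t + 2 * m ≤ H)
    {k : Fin H} (hk : (k : ℕ) < 2 * m) :
    |tent m ((finRotate H ^ t) k) - tent m ((finRotate H ^ t)⁻¹ ((finRotate H ^ t) k))| =
      tent m k := by
  rw [val_finRotate_pow t k (by lia), tent_eq_zero (i := k + t) (by lia), Equiv.Perm.inv_def,
    Equiv.symm_apply_apply,
    zero_sub, abs_neg, abs_of_nonneg (tent_nonneg m k)]

theorem tent_sub_tent_finRotate_pow_inl {m H t : ℕ} (h2 : 2 * m ≤ t) (ht : t + 2 * m ≤ H)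
    {i : Fin H} (hi : (i : ℕ) < 2 * m) :
    |tent m i - tent m ((finRotate H ^ t)⁻¹ i)| = tent m i := by
  obtain ⟨k, rfl⟩ := (finRotate H ^ t).surjective i
  rw [Equiv.Perm.inv_def, Equiv.symm_apply_apply]
  have hk : 2 * m ≤ (k : ℕ) + 1 := by
    by_contra hk
    rw [val_finRotate_pow t k (by lia)] at hi
    lia
  rw [tent_eq_zero hk, sub_zero, abs_of_nonneg (tent_nonneg _ _)]

theorem stmt10 (m H : ℕ) (hm : 1 ≤ m) (hH : 4 * m ≤ H)
    (N : (Fin H → ℝ) → ℝ)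
    (hN0 : ∀ x, N x = 0 ↔ x = 0)
    (hNadd : ∀ x y, N (x + y) ≤ N x + N y)
    (hNsmul : ∀ (c : ℝ) (x), N (c • x) = |c| * N x)
    (hNperm : ∀ (π : Equiv.Perm (Fin H)) (x : Fin H → ℝ), N (fun i => x (π i)) = N x)
    (hNabs : ∀ x : Fin H → ℝ, N (fun i => |x i|) = N x)
    (hNmono : ∀ x y : Fin H → ℝ, (∀ i, 0 ≤ x i) → (∀ i, x i ≤ y i) → N x ≤ N y)
    (S : (Fin H → ℝ) →ₗ[ℝ] (Fin H → ℝ))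
    (hS : ∀ x : Fin H → ℝ, S x = x ∘ (finRotate H).symm)
    (w : Fin H → ℝ)
    (hw : ∀ i : Fin H, w i = if (i : ℕ) < m then 1 else if (i : ℕ) < 2 * m then -1 else 0)
    (wt : ℕ → Fin H → ℝ)
    (hwt : ∀ t : ℕ, wt t = ∑ l ∈ Finset.range t, (S ^ l) w) :
    wt H = 0 ∧ (∀ t : ℕ, 1 ≤ t → wt (t + H) = wt t) ∧
    ∀ t : ℕ, 2 * m ≤ t → t ≤ H - 2 * m →
      ((m : ℝ) / 2 * N w ≤ N (wt t) ∧ ∀ s : ℕ, 1 ≤ s → N (wt s) ≤ N (wt t)) := by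
  have hST : ∀ (l : ℕ) (x : Fin H → ℝ) (i : Fin H), (S ^ l) x i = x ((finRotate H ^ l)⁻¹ i) := by
    intro l
    induction l with
    | zero => simp
    | succ l ih =>
      intro x i
      rw [pow_succ, Module.End.mul_apply, ih, hS, pow_succ, mul_inv_rev]
      rfl
  have hwt' : ∀ (t : ℕ) (i : Fin H), wt t i = tent m i - tent m ((finRotate H ^ t)⁻¹ i) := by
    intro t i
    have hstep : ∀ l : ℕ, (S ^ l) w i =
        tent m ((finRotate H ^ l)⁻¹ i) - tent m ((finRotate H ^ (l + 1))⁻¹ i) := by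
      intro l
      rw [hST, hw, ← tent_sub_tent_finRotate hm (by lia), pow_succ, mul_inv_rev]
      rfl
    rw [hwt, Finset.sum_apply, Finset.sum_congr rfl fun l _ => hstep l, Finset.sum_range_sub']
    simp
  refine ⟨?_, fun t _ => ?_, fun t h2 ht => ⟨?_, fun s _ => ?_⟩⟩
  · ext i
    simp [hwt', finRotate_pow_self]
  · ext i
    simp [hwt', pow_add, finRotate_pow_self]
  · replace ht : t + 2 * m ≤ H := by lia
    have hscale : (m : ℝ) / 2 * N w = N (((m : ℝ) / 2) • w) := by
      rw [hNsmul, abs_of_nonneg (by positivity)]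
    rw [hscale]
    let a := (m - 1) / 2
    let f : Fin H → Fin H := fun i =>
      if (i : ℕ) < m then ⟨(i + a) % H, Nat.mod_lt _ (by lia)⟩
      else ⟨(i - m + a + t) % H, Nat.mod_lt _ (by lia)⟩
    have hsupp : ∀ i, (((m : ℝ) / 2) • w) i ≠ 0 → (i : ℕ) < 2 * m := by
      intro i hi
      by_contra h
      exact hi (by simp [hw, h, show ¬ (i : ℕ) < m by lia])
    have hf₁ : ∀ i : Fin H, (i : ℕ) < m → (f i : ℕ) = i + a := by
      intro i hi
      simp only [f, if_pos hi]
      exact Nat.mod_eq_of_lt (by lia)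
    have hf₂ : ∀ i : Fin H, m ≤ (i : ℕ) → (i : ℕ) < 2 * m → (f i : ℕ) = i - m + a + t := by
      intro i hi hi'
      simp only [f, if_neg (not_lt.mpr hi)]
      exact Nat.mod_eq_of_lt (by lia)
    refine symmetric_le_of_injOn hNperm hNabs hNmono f ?_ ?_
    · intro i hi j hj hij
      have hi := hsupp i hi
      have hj := hsupp j hj
      have hij := congrArg Fin.val hij
      ext
      rcases lt_or_ge (i : ℕ) m with h | h <;> rcases lt_or_ge (j : ℕ) m with h' | h' <;>
        simp only [hf₁, hf₂, h, h', hi, hj] at hij <;> lia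
    · intro i hi
      have hi := hsupp i hi
      have habs : |(((m : ℝ) / 2) • w) i| = (m : ℝ) / 2 := by
        rw [Pi.smul_apply, hw, smul_eq_mul, abs_mul, abs_of_nonneg (by positivity : (0 : ℝ) ≤ m / 2)]
        split_ifs <;> simp
      rw [habs, hwt']
      rcases lt_or_ge (i : ℕ) m with h | h
      · have := hf₁ i h
        rw [tent_sub_tent_finRotate_pow_inl h2 ht (by lia), this]
        exact half_le_tent h
      · let k : Fin H := ⟨i - m + a, by lia⟩
        have hk : f i = (finRotate H ^ t) k := by
          ext
          rw [hf₂ i h hi, val_finRotate_pow _ _ (by simp only [k]; lia)]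
        rw [hk, tent_sub_tent_finRotate_pow_inr h2 ht (by simp only [k]; lia)]
        exact half_le_tent (by lia)
  · replace ht : t + 2 * m ≤ H := by lia
    let b : Fin H → Fin H := fun i => (finRotate H ^ s)⁻¹ i
    have hpos : ∀ i, wt s i ≠ 0 → tent m (b i) ≤ tent m i → (i : ℕ) < 2 * m := by
      intro i hi hle
      by_contra h
      rw [tent_eq_zero (i := i) (by lia)] at hle
      refine hi ?_
      rw [hwt', tent_eq_zero (i := i) (by lia), le_antisymm hle (tent_nonneg _ _), sub_zero]
    have hneg : ∀ i, ¬ tent m (b i) ≤ tent m i → (b i : ℕ) < 2 * m := by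
      intro i hle
      by_contra h
      exact hle (by rw [tent_eq_zero (i := b i) (by lia)]; exact tent_nonneg _ _)
    refine symmetric_le_of_injOn hNperm hNabs hNmono
      (fun i => if tent m (b i) ≤ tent m i then i else (finRotate H ^ t) (b i)) ?_ ?_
    · have hcross : ∀ i j, wt s i ≠ 0 → tent m (b i) ≤ tent m i → ¬ tent m (b j) ≤ tent m j →
          i ≠ (finRotate H ^ t) (b j) := by
        intro i j hi h h' hij
        have h₁ := hpos i hi h
        have h₂ := hneg j h'
        rw [hij, val_finRotate_pow _ _ (by lia)] at h₁
        lia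
      intro i hi j hj hij
      dsimp only at hij
      split_ifs at hij with h h' h'
      · exact hij
      · exact absurd hij (hcross i j hi h h')
      · exact absurd hij.symm (hcross j i hj h' h)
      · exact (finRotate H ^ s)⁻¹.injective ((finRotate H ^ t).injective hij)
    · intro i hi
      rw [hwt' s, hwt' t]
      split_ifs with h
      · rw [tent_sub_tent_finRotate_pow_inl h2 ht (hpos i hi h), abs_of_nonneg (sub_nonneg.mpr h)]
        exact sub_le_self _ (tent_nonneg _ _)
      · rw [tent_sub_tent_finRotate_pow_inr h2 ht (hneg i h), abs_sub_comm,
          abs_of_nonneg (sub_nonneg.mpr (not_le.mp h).le)]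
        exact sub_le_self _ (tent_nonneg _ _)
end

section
/- Let X be a complex Banach space. Then the set 𝒫 = {R bounded linear operator on X : A_R = ∅ or A_R is dense in X} is dense, for the operator norm topology, in the space of all bounded linear operators on X; that is, for every bounded operator R on X and every ε > 0 there exists S ∈ 𝒫 with ‖R − S‖ ≤ ε. -/
open Filter Topology Set

/-- The set of points whose orbit under `R` tends to infinity in norm. -/
def setA {𝕜 X : Type*} [NontriviallyNormedField 𝕜] [NormedAddCommGroup X]
    [NormedSpace 𝕜 X] (R : X →L[𝕜] X) : Set X :=
  {x | Tendsto (fun t : ℕ => ‖(R ^ t) x‖) atTop atTop}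

section

variable {X : Type*} [NormedAddCommGroup X] [NormedSpace ℂ X]

/-- If the orbits of `T` are eventually dominated by their starting point, none is unbounded. -/
lemma setA_eq_empty_of_eventually_norm_pow_le_one {T : X →L[ℂ] X}
    (hT : ∀ᶠ n : ℕ in atTop, ‖T ^ n‖ ≤ 1) : setA T = ∅ := by
  refine eq_empty_of_forall_notMem fun x (hx : Tendsto _ _ _) => ?_
  obtain ⟨n, hn, hn'⟩ := (hT.and (hx.eventually_gt_atTop ‖x‖)).exists
  have := (T ^ n).le_of_opNorm_le hn x
  linarith

/-- An operator with an eigenvalue outside the closed unit disc has a dense set of orbits tending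
to infinity: on almost every point of each line in the direction of the eigenvector, the orbit
tends to infinity, by the Borel-Cantelli lemma. -/
lemma dense_setA_of_eigenvector {T : X →L[ℂ] X} {x : X} {μ : ℂ} (hx : ‖x‖ = 1)
    (hTx : T x = μ • x) (hμ : 1 < ‖μ‖) : Dense (setA T) := by
  have hpow (n : ℕ) : (T ^ n) x = μ ^ n • x := by
    induction n with
    | zero => simp
    | succ n ih => rw [pow_succ', mul_apply_eq_comp, ih, map_smul, hTx, smul_smul,
        pow_succ]
  have hμ0 : 0 < ‖μ‖ := by linarith
  refine Metric.dense_iff.2 fun y η hη => ?_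
  let s : ℕ → Set ℝ := fun n => {c | ‖(T ^ n) (y + (c : ℂ) • x)‖ < n}
  have hs (n : ℕ) : MeasureTheory.volume (s n) ≤ ENNReal.ofReal (2 * (n * ‖μ‖⁻¹ ^ n)) := by
    refine (Real.volume_le_diam _).trans (Metric.ediam_le fun c hc d hd => ?_)
    rw [edist_dist]
    refine ENNReal.ofReal_le_ofReal ?_
    have hsub : (T ^ n) (y + (c : ℂ) • x) - (T ^ n) (y + (d : ℂ) • x)
        = (((c - d : ℝ) : ℂ) * μ ^ n) • x := by
      rw [← map_sub, add_sub_add_left_eq_sub, ← sub_smul, map_smul, hpow, smul_smul]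
      push_cast; rfl
    have hle := norm_sub_le ((T ^ n) (y + (c : ℂ) • x)) ((T ^ n) (y + (d : ℂ) • x))
    rw [hsub, norm_smul, hx, mul_one, norm_mul, norm_pow, Complex.norm_real] at hle
    have hc' : ‖(T ^ n) (y + (c : ℂ) • x)‖ < n := hc
    have hd' : ‖(T ^ n) (y + (d : ℂ) • x)‖ < n := hd
    rw [dist_eq_norm, inv_pow, ← mul_assoc, ← div_eq_mul_inv, le_div_iff₀ (by positivity)]
    linarith
  have hsum : Summable fun n : ℕ => 2 * ((n : ℝ) * ‖μ‖⁻¹ ^ n) := by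
    have := summable_pow_mul_geometric_of_norm_lt_one (R := ℝ) 1 (r := ‖μ‖⁻¹)
      (by rw [norm_inv, norm_norm]; exact inv_lt_one_of_one_lt₀ hμ)
    simpa using this.mul_left 2
  have hae := MeasureTheory.ae_eventually_notMem (μ := MeasureTheory.volume) (s := s)
    (ne_top_of_le_ne_top hsum.tsum_ofReal_ne_top (ENNReal.tsum_le_tsum hs))
  obtain ⟨c, hc, hcη⟩ :=
    (MeasureTheory.Measure.dense_of_ae hae).exists_mem_open Metric.isOpen_ball
      ⟨0, Metric.mem_ball_self hη⟩
  refine ⟨y + (c : ℂ) • x, ?_, ?_⟩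
  · rw [mem_ball_iff_norm, add_sub_cancel_left, norm_smul, hx, mul_one, Complex.norm_real]
    simpa using hcη
  · refine tendsto_atTop_mono' _ ?_ tendsto_natCast_atTop_atTop
    filter_upwards [hc] with n hn using not_lt.1 hn

/-- Every point of the spectral circle is approximated by approximate eigenvalues of larger
modulus. -/
lemma exists_approx_eigenvector [CompleteSpace X] {R : X →L[ℂ] X} (hR : 1 < spectralRadius ℂ R)
    {ε : ℝ} (hε : 0 < ε) : ∃ (μ : ℂ) (x : X), 1 < ‖μ‖ ∧ ‖x‖ = 1 ∧ ‖R x - μ • x‖ ≤ ε := by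
  obtain ⟨l, hl, -⟩ : ∃ l ∈ spectrum ℂ R, 1 < (‖l‖₊ : ENNReal) := by
    simpa only [spectralRadius, lt_iSup_iff, exists_prop] using hR
  obtain ⟨l, hl, hlr⟩ := spectrum.exists_nnnorm_eq_spectralRadius_of_nonempty ⟨l, hl⟩
  have hl1 : 1 < ‖l‖ := by
    rw [← hlr] at hR
    exact_mod_cast hR
  have hl0 : 0 < ‖l‖ := by linarith
  set δ : ℝ := ε / (2 * ‖l‖) with hδ
  have hδ0 : 0 < δ := by positivity
  set μ : ℂ := (1 + δ : ℝ) * l with hμ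
  have hμl : ‖μ‖ = (1 + δ) * ‖l‖ := by
    rw [hμ, norm_mul, Complex.norm_real, Real.norm_of_nonneg (by positivity)]
  have hlμ : ‖l‖ < ‖μ‖ := by nlinarith
  have hdist : ‖l - μ‖ < ε := by
    have : l - μ = -((δ : ℂ) * l) := by rw [hμ]; push_cast; ring
    rw [this, norm_neg, norm_mul, Complex.norm_real, Real.norm_of_nonneg hδ0.le, hδ]
    field_simp
    linarith
  refine ⟨μ, ?_⟩
  by_contra! hcon
  have hbelow (x : X) : ε * ‖x‖ ≤ ‖R x - μ • x‖ := by
    rcases eq_or_ne x 0 with rfl | hx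
    · simp
    have hx0 : ‖x‖ ≠ 0 := norm_ne_zero_iff.2 hx
    have h := hcon (((‖x‖⁻¹ : ℝ) : ℂ) • x) (hl1.trans hlμ) (by
      rw [norm_smul, Complex.norm_real, norm_inv, norm_norm, inv_mul_cancel₀ hx0])
    rw [map_smul, smul_comm μ, ← smul_sub, norm_smul, Complex.norm_real, norm_inv, norm_norm,
      inv_mul_eq_div, lt_div_iff₀ (by positivity)] at h
    exact h.le
  have hμres : μ ∈ resolventSet ℂ R :=
    spectrum.mem_resolventSet_of_spectralRadius_lt (by rw [← hlr]; exact_mod_cast hlμ)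
  obtain ⟨u, hu⟩ : IsUnit (algebraMap ℂ (X →L[ℂ] X) μ - R) := hμres
  have huinv : ‖(↑u⁻¹ : X →L[ℂ] X)‖ ≤ ε⁻¹ := by
    refine ContinuousLinearMap.opNorm_le_bound _ (by positivity) fun y => ?_
    have h := hbelow ((↑u⁻¹ : X →L[ℂ] X) y)
    have hy : R ((↑u⁻¹ : X →L[ℂ] X) y) - μ • (↑u⁻¹ : X →L[ℂ] X) y = -y := by
      have : (↑u : X →L[ℂ] X) ((↑u⁻¹ : X →L[ℂ] X) y) = y := by
        rw [← mul_apply_eq_comp, Units.mul_inv, one_apply_eq_self]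
      rw [hu, sub_apply, ContinuousLinearMap.algebraMap_apply] at this
      rw [← neg_sub, this]
    rw [hy, norm_neg] at h
    rwa [inv_mul_eq_div, le_div_iff₀ hε, mul_comm]
  have hX : Nontrivial X := by
    by_contra hX
    rw [not_nontrivial_iff_subsingleton] at hX
    rw [spectrum.of_subsingleton] at hl
    exact hl
  refine hl ((u.ofNearby (algebraMap ℂ (X →L[ℂ] X) l - R) ?_).isUnit)
  rw [hu, sub_sub_sub_cancel_right, ← map_sub, norm_algebraMap']
  exact hdist.trans_le ((le_inv_comm₀ hε (Units.norm_pos u⁻¹)).2 huinv)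

/-- An approximate eigenvector becomes an eigenvector after a small rank one perturbation. -/
lemma exists_norm_sub_le_of_approx_eigenvector (R : X →L[ℂ] X) {x : X} (hx : ‖x‖ = 1) (μ : ℂ) :
    ∃ S : X →L[ℂ] X, S x = μ • x ∧ ‖R - S‖ ≤ ‖R x - μ • x‖ := by
  obtain ⟨f, hf, hfx⟩ := exists_dual_vector ℂ x (norm_ne_zero_iff.1 (by simp [hx]))
  refine ⟨R - f.smulRight (R x - μ • x), ?_, ?_⟩
  · simp [hfx, hx]
  · rw [sub_sub_cancel, ContinuousLinearMap.norm_smulRight_apply, hf, one_mul]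

lemma eventually_norm_pow_smul_le_one [CompleteSpace X] {R : X →L[ℂ] X}
    (hR : spectralRadius ℂ R ≤ 1) {s : ℝ} (hs0 : 0 < s) (hs1 : s < 1) :
    ∀ᶠ n : ℕ in atTop, ‖((s : ℂ) • R) ^ n‖ ≤ 1 := by
  have hlt : spectralRadius ℂ R < ENNReal.ofReal s⁻¹ :=
    hR.trans_lt (ENNReal.one_lt_ofReal.2 ((one_lt_inv₀ hs0).2 hs1))
  filter_upwards [(spectrum.pow_norm_pow_one_div_tendsto_nhds_spectralRadius R).eventually_lt_const
    hlt, eventually_gt_atTop 0] with n hn hn0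
  have h := (ENNReal.ofReal_lt_ofReal_iff (by positivity)).1 hn
  have h' := pow_le_pow_left₀ (by positivity) h.le n
  rw [one_div, Real.rpow_inv_natCast_pow (norm_nonneg _) hn0.ne', inv_pow] at h'
  rw [smul_pow, norm_smul, norm_pow, Complex.norm_real, Real.norm_of_nonneg hs0.le, mul_comm]
  rwa [← one_div, le_div_iff₀ (by positivity)] at h'

end

theorem stmt15 (X : Type*) [NormedAddCommGroup X] [NormedSpace ℂ X] [CompleteSpace X] :
    ∀ R : X →L[ℂ] X, ∀ ε : ℝ, 0 < ε →
      ∃ S : X →L[ℂ] X, (setA S = ∅ ∨ Dense (setA S)) ∧ ‖R - S‖ ≤ ε := by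
  intro R ε hε
  rcases le_or_gt (spectralRadius ℂ R) 1 with hR | hR
  · have hpos : 0 < ‖R‖ + 1 + ε := by positivity
    set s : ℝ := (‖R‖ + 1) / (‖R‖ + 1 + ε) with hs
    have hs1 : s < 1 := by rw [hs, div_lt_one hpos]; linarith
    refine ⟨(s : ℂ) • R, Or.inl (setA_eq_empty_of_eventually_norm_pow_le_one
      (eventually_norm_pow_smul_le_one hR (by positivity) hs1)), ?_⟩
    have hsub : R - (s : ℂ) • R = ((1 - s : ℝ) : ℂ) • R := by
      push_cast
      rw [sub_smul, one_smul]
    rw [hsub, norm_smul, Complex.norm_real, Real.norm_of_nonneg (by linarith)]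
    have h1s : 1 - s = ε / (‖R‖ + 1 + ε) := by rw [hs]; field_simp; ring
    rw [h1s, div_mul_eq_mul_div, div_le_iff₀ hpos]
    nlinarith
  · obtain ⟨μ, x, hμ, hx, hRx⟩ := exists_approx_eigenvector hR hε
    obtain ⟨S, hSx, hRS⟩ := exists_norm_sub_le_of_approx_eigenvector R hx μ
    exact ⟨S, Or.inr (dense_setA_of_eigenvector hx hSx hμ), hRS.trans hRx⟩
end
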